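/- Let (A,d,ω) be a dg symplectic space, C₁ ∌ a and C₂ ∌ b disjoint finite sets, f ∈ End_A(C₁⊔{a},G₁) and g ∈ End_A(C₂⊔{b},G₂) homogeneous. Then there is a unique element ∘_{a,b}(f⊗g) ∈ End_A(C₁⊔C₂,G₁+G₂) such that ∘_{a,b}(f⊗g)∘ι_ψ equals Σ_i (−1)^{|f|+|g||b_i|} μ∘((f∘ι_{ψ₁})(a_i⊗id^{⊗|C₁|}) ⊗ (g∘ι_{ψ₂})(b_i⊗id^{⊗|C₂|})) for every bijection ψ : C₁⊔C₂ ≅ [|C₁|+|C₂|] with ψ(C₁) = [|C₁|]; moreover this element is independent of the choice of homogeneous basis {a_i} of A. -/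

import Mathlib

open Finset

noncomputable section

namespace Paper

variable (k : Type) [Field k]

/-- `msign m = (−1)^m`. -/
def msign (m : ℤ) : k := if Odd m then -1 else 1

/-- The Koszul sign of the action of a permutation `τ` on a tensor product of
homogeneous factors of degrees `d i`. -/
def koszulSign {n : ℕ} (d : Fin n → ℤ) (τ : Equiv.Perm (Fin n)) : k :=
  ∏ i : Fin n, ∏ j : Fin n,
    if i < j ∧ τ j < τ i ∧ Odd (d i) ∧ Odd (d j) then (-1 : k) else (1 : k)

variable (ι : Type) [Fintype ι] [DecidableEq ι]

/-- The `n`-th tensor power `A^{⊗n}` of the graded vector space `A` with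
homogeneous basis indexed by `ι`, in coordinates. -/
abbrev TPow (n : ℕ) : Type := (Fin n → ι) →₀ k

variable (deg : ι → ℤ)

/-- The Koszul-signed action of `τ ∈ Σ_n` on `A^{⊗n}`. -/
def permAct {n : ℕ} (τ : Equiv.Perm (Fin n)) : TPow k ι n →ₗ[k] TPow k ι n :=
  Finsupp.lift (TPow k ι n) k (Fin n → ι)
    (fun I => koszulSign k (fun p => deg (I p)) τ • Finsupp.single (I ∘ τ.symm) (1 : k))

variable (S : Finset ℕ)

/-- The direct sum `⊕_{ψ : C ≃ [n]} A^{⊗n}` over all bijections `ψ`. -/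
abbrev PreT : Type := ((↥S ≃ Fin S.card) × (Fin S.card → ι)) →₀ k

/-- The inclusion `i_ψ` of the `ψ`-th summand. -/
def iPre (ψ : ↥S ≃ Fin S.card) : TPow k ι S.card →ₗ[k] PreT k ι S :=
  Finsupp.lift (PreT k ι S) k (Fin S.card → ι) (fun I => Finsupp.single (ψ, I) (1 : k))

/-- The submodule of relations `i_ψ(v) ∼ i_{τψ}(τ(v))`. -/
def tensRel : Submodule k (PreT k ι S) :=
  Submodule.span k
    {x | ∃ (ψ : ↥S ≃ Fin S.card) (τ : Equiv.Perm (Fin S.card)) (v : TPow k ι S.card),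
      x = iPre k ι S ψ v - iPre k ι S (ψ.trans τ) (permAct k ι deg τ v)}

/-- The unordered tensor product `⊗_C A := (⊕_ψ A^{⊗n})/∼`. -/
abbrev TensC : Type := PreT k ι S ⧸ tensRel k ι deg S

/-- The structure map `ι_ψ : A^{⊗n} → ⊗_C A`. -/
def iota (ψ : ↥S ≃ Fin S.card) : TPow k ι S.card →ₗ[k] TensC k ι deg S :=
  (tensRel k ι deg S).mkQ.comp (iPre k ι S ψ)

/-- A dg symplectic space over `k`, presented by a homogeneous basis `{a_i}_{i : ι}`. -/
structure SympData where
  deg : ι → ℤ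
  dm : Matrix ι ι k
  ω : Matrix ι ι k
  even_dim : Even (Fintype.card ι)
  dm_homog : ∀ i j, dm j i ≠ 0 → deg j = deg i + 1
  dm_sq : dm * dm = 0
  ω_homog : ∀ i j, ω i j ≠ 0 → deg i + deg j = 1
  ω_antisymm : ∀ i j, ω i j = - (msign k (deg i * deg j) * ω j i)
  ω_unit : IsUnit ω
  ω_d : ∀ i j, (∑ l, dm l i * ω l j) + msign k (deg i) * (∑ l, dm l j * ω i l) = 0

variable {k ι}

/-- Coefficient matrix of `Σ_i a'_i ⊗ b'_i` for a basis with degrees `deg'` and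
form matrix `ω'`; `b'_i := Σ_j (−1)^{|a'_j|} (ω'⁻¹)_{ij} a'_j`. -/
def binvOf (deg' : ι → ℤ) (ω' : Matrix ι ι k) : Matrix ι ι k :=
  fun i j => msign k (deg' j) * ω'⁻¹ i j

/-- Coefficients of `b_i` in the given basis: `binv i j` is the coefficient of `a_j` in `b_i`. -/
def SympData.binv (A : SympData k ι) : Matrix ι ι k := binvOf A.deg A.ω

variable (A : SympData k ι)

/-- The endomorphism operad component `End_A(C,G) := Hom(⊗_C A, k)`
(the genus `G` only enters through stability). -/
abbrev EndS (S : Finset ℕ) : Type := TensC k ι A.deg S →ₗ[k] k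

/-- `f` is homogeneous of degree `m` (as a functional on the graded space `⊗_C A`). -/
def IsHomogEnd {S : Finset ℕ} (f : EndS A S) (m : ℤ) : Prop :=
  ∀ (ψ : ↥S ≃ Fin S.card) (I : Fin S.card → ι),
    f (iota k ι A.deg S ψ (Finsupp.single I 1)) ≠ 0 → (∑ p, A.deg (I p)) + m = 0

/-- The defining property of the composition `∘_{a,b}(f⊗g)` of the twisted
endomorphism operad, relative to an arbitrary homogeneous basis `{a'_i = Σ_p P p i a_p}`
with degrees `deg'`:  for every `ψ : C₁⊔C₂ ≅ [n]` with `ψ(C₁) = [|C₁|]`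
(and the induced `ψ₁ : C₁⊔{a} ≅ [|C₁|+1]`, `ψ₂ : C₂⊔{b} ≅ [|C₂|+1]`),
`h∘ι_ψ = Σ_i (−1)^{|f|+|g||b'_i|} μ∘((f∘ι_{ψ₁})(a'_i⊗id^{⊗|C₁|}) ⊗ (g∘ι_{ψ₂})(b'_i⊗id^{⊗|C₂|}))`,
where the tensor product of the two graded functionals is evaluated with the Koszul sign. -/
def CompPropWith (P : Matrix ι ι k) (deg' : ι → ℤ)
    (a b : ℕ) (C₁ C₂ S₁ S₂ D : Finset ℕ) (df dg : ℤ)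
    (f : EndS A S₁) (g : EndS A S₂) (h : EndS A D) : Prop :=
  ∀ (ψ : ↥D ≃ Fin D.card) (ψ₁ : ↥S₁ ≃ Fin S₁.card) (ψ₂ : ↥S₂ ≃ Fin S₂.card),
    (∀ x : ↥D, (x : ℕ) ∈ C₁ → (ψ x : ℕ) < C₁.card) →
    (∀ x : ↥S₁, ((x : ℕ) = a ↔ (ψ₁ x : ℕ) = 0)) →
    (∀ (x : ↥S₁) (hx : (x : ℕ) ∈ D), (x : ℕ) ∈ C₁ → (ψ₁ x : ℕ) = (ψ ⟨x, hx⟩ : ℕ) + 1) →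
    (∀ x : ↥S₂, ((x : ℕ) = b ↔ (ψ₂ x : ℕ) = 0)) →
    (∀ (x : ↥S₂) (hx : (x : ℕ) ∈ D), (x : ℕ) ∈ C₂ → (ψ₂ x : ℕ) + C₁.card = (ψ ⟨x, hx⟩ : ℕ) + 1) →
    ∀ I : Fin D.card → ι,
      h (iota k ι A.deg D ψ (Finsupp.single I 1)) =
        ∑ i : ι, ∑ j : ι,
          msign k (df + dg * (1 - deg' i) +
              (dg + 1 - deg' i) * (∑ x : ↥D, if (x : ℕ) ∈ C₁ then A.deg (I (ψ x)) else 0)) *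
            binvOf deg' (P.transpose * A.ω * P) i j *
            (∑ p : ι, P p i *
              f (iota k ι A.deg S₁ ψ₁ (Finsupp.single
                (fun r => if hx : ((ψ₁.symm r : ℕ) ∈ D) ∧ ((ψ₁.symm r : ℕ) ∈ C₁)
                  then I (ψ ⟨(ψ₁.symm r : ℕ), hx.1⟩) else p) 1))) *
            (∑ q : ι, P q j *
              g (iota k ι A.deg S₂ ψ₂ (Finsupp.single
                (fun r => if hx : ((ψ₂.symm r : ℕ) ∈ D) ∧ ((ψ₂.symm r : ℕ) ∈ C₂)
                  then I (ψ ⟨(ψ₂.symm r : ℕ), hx.1⟩) else q) 1)))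

/-- The defining property of `∘_{a,b}(f⊗g)` in the standard basis. -/
def CompProp (a b : ℕ) (C₁ C₂ S₁ S₂ D : Finset ℕ) (df dg : ℤ)
    (f : EndS A S₁) (g : EndS A S₂) (h : EndS A D) : Prop :=
  CompPropWith A 1 A.deg a b C₁ C₂ S₁ S₂ D df dg f g h

/-- The composition `∘_{a,b}(f⊗g)` of the twisted endomorphism operad, defined
as the element satisfying its defining property (it exists and is unique). -/
def compEl (a b : ℕ) (C₁ C₂ S₁ S₂ D : Finset ℕ) (df dg : ℤ)
    (f : EndS A S₁) (g : EndS A S₂) : EndS A D :=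
  @Classical.epsilon _ ⟨0⟩ (CompProp A a b C₁ C₂ S₁ S₂ D df dg f g)

/-- The defining property of the contraction `ξ_{ab}(f)` of the twisted
endomorphism operad:  for every `ψ : C ≅ [|C|]` and the induced
`ψ' : C⊔{a,b} ≅ [|C|+2]` (`ψ'(a) = 1`, `ψ'(b) = 2`, `ψ'(c) = ψ(c)+2`),
`h∘ι_ψ = (−1)^{|f|} Σ_i (f∘ι_{ψ'})(a_i⊗b_i⊗id^{⊗|C|})`. -/
def XiProp (a b : ℕ) (Ssrc C : Finset ℕ) (df : ℤ)
    (f : EndS A Ssrc) (h : EndS A C) : Prop :=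
  ∀ (ψ : ↥C ≃ Fin C.card) (ψ' : ↥Ssrc ≃ Fin Ssrc.card),
    (∀ x : ↥Ssrc, ((x : ℕ) = a ↔ (ψ' x : ℕ) = 0)) →
    (∀ x : ↥Ssrc, ((x : ℕ) = b ↔ (ψ' x : ℕ) = 1)) →
    (∀ (x : ↥Ssrc) (hx : (x : ℕ) ∈ C), (ψ' x : ℕ) = (ψ ⟨x, hx⟩ : ℕ) + 2) →
    ∀ I : Fin C.card → ι,
      h (iota k ι A.deg C ψ (Finsupp.single I 1)) =
        msign k df * ∑ i : ι, ∑ j : ι,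
          A.binv i j *
            f (iota k ι A.deg Ssrc ψ' (Finsupp.single
              (fun r => if hx : ((ψ'.symm r : ℕ) ∈ C)
                then I (ψ ⟨(ψ'.symm r : ℕ), hx⟩)
                else if (ψ'.symm r : ℕ) = a then i else j) 1))

/-- The contraction `ξ_{ab}(f)` of the twisted endomorphism operad. -/
def xiEl (a b : ℕ) (Ssrc C : Finset ℕ) (df : ℤ) (f : EndS A Ssrc) : EndS A C :=
  @Classical.epsilon _ ⟨0⟩ (XiProp A a b Ssrc C df f)

/-- The defining property of the differential on `End_A(C,G)`:
`d(f)∘ι_ψ = (−1)^{|f|} Σ_{i=0}^{n−1} (f∘ι_ψ)(id^{⊗i}⊗d⊗id^{⊗(n−i−1)})`,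
tensor products of graded maps being evaluated with Koszul signs. -/
def DiffProp (S : Finset ℕ) (df : ℤ) (f h : EndS A S) : Prop :=
  ∀ (ψ : ↥S ≃ Fin S.card) (I : Fin S.card → ι),
    h (iota k ι A.deg S ψ (Finsupp.single I 1)) =
      msign k df * ∑ p : Fin S.card,
        msign k (∑ q : Fin S.card, if (q : ℕ) < (p : ℕ) then A.deg (I q) else 0) *
          ∑ j : ι, A.dm j (I p) *
            f (iota k ι A.deg S ψ (Finsupp.single (Function.update I p j) 1))

/-- The differential of the twisted endomorphism operad, on homogeneous
elements of degree `df`. -/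
def dEl (S : Finset ℕ) (df : ℤ) (f : EndS A S) : EndS A S :=
  @Classical.epsilon _ ⟨0⟩ (DiffProp A S df f)

/-- The defining property of the relabeling map `End_A(ρ) : End_A(C,G) → End_A(D,G)`
for a bijection `ρ : C ≅ D`:  `End_A(ρ)(f)∘ι_ψ = f∘ι_{ψρ}`. -/
def RelabelProp (ρ : ℕ → ℕ) (C D : Finset ℕ) (f : EndS A C) (h : EndS A D) : Prop :=
  ∀ (hρ : ∀ x : ↥C, ρ x ∈ D) (ψD : ↥D ≃ Fin D.card) (ψC : ↥C ≃ Fin C.card),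
    (∀ x : ↥C, (ψC x : ℕ) = (ψD ⟨ρ x, hρ x⟩ : ℕ)) →
    ∀ I : Fin D.card → ι,
      h (iota k ι A.deg D ψD (Finsupp.single I 1)) =
        f (iota k ι A.deg C ψC (Finsupp.single
          (fun p => I (ψD ⟨ρ (ψC.symm p), hρ _⟩)) 1))

/-- The relabeling map `End_A(ρ)` of the endomorphism operad. -/
def relabelEnd (ρ : ℕ → ℕ) (C D : Finset ℕ) (f : EndS A C) : EndS A D :=
  @Classical.epsilon _ ⟨0⟩ (RelabelProp A ρ C D f)

/-- Stability of the corolla `(C,G)` : `2(G−1)+|C| > 0`. -/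
def StableCorolla (C : Finset ℕ) (G : ℕ) : Prop := 2 < 2 * G + C.card

end Paper

namespace Paper

/-- Koszul sign comparing two orderings of a label set. -/
def Kp (k : Type) [Field k] (S : Finset ℕ) (r r' : ℕ → ℕ) (d : ℕ → ℤ) : k :=
  ∏ x ∈ S, ∏ y ∈ S,
    if r x < r y ∧ r' y < r' x ∧ Odd (d x) ∧ Odd (d y) then (-1 : k) else 1

/-- Koszul sign comparing an ordering with the standard one. -/
def Ep (k : Type) [Field k] (S : Finset ℕ) (r : ℕ → ℕ) (d : ℕ → ℤ) : k :=
  ∏ x ∈ S, ∏ y ∈ S,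
    if x < y ∧ r y < r x ∧ Odd (d x) ∧ Odd (d y) then (-1 : k) else 1

lemma Kp_eq (k : Type) [Field k] (S : Finset ℕ) (r r' : ℕ → ℕ) (d : ℕ → ℤ)
    (hr : Set.InjOn r S) (hr' : Set.InjOn r' S) :
    Kp k S r r' d = Ep k S r d * Ep k S r' d := by
  have h1 : Kp k S r r' d =
      (∏ x ∈ S, ∏ y ∈ S, if x < y ∧ r x < r y ∧ r' y < r' x ∧ Odd (d x) ∧ Odd (d y)
        then (-1 : k) else 1) *
      (∏ x ∈ S, ∏ y ∈ S, if x < y ∧ r y < r x ∧ r' x < r' y ∧ Odd (d x) ∧ Odd (d y)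
        then (-1 : k) else 1) := by
    rw [Finset.prod_comm (s := S) (t := S) (f := fun x y =>
      if x < y ∧ r y < r x ∧ r' x < r' y ∧ Odd (d x) ∧ Odd (d y) then (-1 : k) else 1)]
    unfold Kp
    rw [← Finset.prod_mul_distrib]
    refine Finset.prod_congr rfl fun x _ => ?_
    rw [← Finset.prod_mul_distrib]
    refine Finset.prod_congr rfl fun y _ => ?_
    rcases lt_trichotomy x y with h | h | h
    · simp [h, h.not_gt]
    · subst h; simp
    · simp only [h, h.not_gt, true_and, false_and, if_false, one_mul]
      congr 1
      apply propext; tauto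
  rw [h1]
  unfold Ep
  rw [← Finset.prod_mul_distrib, ← Finset.prod_mul_distrib]
  refine Finset.prod_congr rfl fun x hx => ?_
  rw [← Finset.prod_mul_distrib, ← Finset.prod_mul_distrib]
  refine Finset.prod_congr rfl fun y hy => ?_
  by_cases h : x < y
  · have e1 : r x ≠ r y := fun e => h.ne (hr hx hy e)
    have e2 : r' x ≠ r' y := fun e => h.ne (hr' hx hy e)
    by_cases o1 : Odd (d x) <;> by_cases o2 : Odd (d y) <;>
      rcases lt_or_gt_of_ne e1 with g1 | g1 <;> rcases lt_or_gt_of_ne e2 with g2 | g2 <;>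
      simp [h, o1, o2, g1, g2, g1.not_gt, g2.not_gt]
  · simp [h]

lemma Ep_sq (k : Type) [Field k] (S : Finset ℕ) (r : ℕ → ℕ) (d : ℕ → ℤ) :
    Ep k S r d * Ep k S r d = 1 := by
  unfold Ep
  rw [← Finset.prod_mul_distrib]
  refine Finset.prod_eq_one fun x hx => ?_
  rw [← Finset.prod_mul_distrib]
  refine Finset.prod_eq_one fun y hy => ?_
  split_ifs <;> simp

/-- Rank function of an ordering. -/
def rk {S : Finset ℕ} (ψ : ↥S ≃ Fin S.card) : ℕ → ℕ :=
  fun x => if h : x ∈ S then (ψ ⟨x, h⟩ : ℕ) else 0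

lemma rk_coe {S : Finset ℕ} (ψ : ↥S ≃ Fin S.card) (x : ↥S) : rk ψ x = (ψ x : ℕ) := by
  simp [rk]

lemma rk_inj {S : Finset ℕ} (ψ : ↥S ≃ Fin S.card) : Set.InjOn (rk ψ) S := by
  intro x hx y hy h
  have := rk_coe ψ ⟨x, hx⟩
  have h2 := rk_coe ψ ⟨y, hy⟩
  simp only at this h2
  rw [this, h2] at h
  have := ψ.injective (Fin.ext h)
  simpa using this

/-- Degree function of a labelling. -/
def dx {ι : Type} (deg : ι → ℤ) {S : Finset ℕ} (J : ↥S → ι) : ℕ → ℤ :=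
  fun x => if h : x ∈ S then deg (J ⟨x, h⟩) else 0

lemma dx_coe {ι : Type} (deg : ι → ℤ) {S : Finset ℕ} (J : ↥S → ι) (x : ↥S) :
    dx deg J x = deg (J x) := by
  simp [dx]

lemma koszul_eq (k : Type) [Field k] {ι : Type} (deg : ι → ℤ) {S : Finset ℕ}
    (ψ ψ' : ↥S ≃ Fin S.card) (J : ↥S → ι) :
    koszulSign k (fun p => deg (J (ψ.symm p))) (ψ.symm.trans ψ') =
      Kp k S (rk ψ) (rk ψ') (dx deg J) := by
  unfold koszulSign Kp
  rw [← Finset.prod_coe_sort S, ← ψ.prod_comp]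
  refine Finset.prod_congr rfl fun x _ => ?_
  rw [← Finset.prod_coe_sort S, ← ψ.prod_comp]
  refine Finset.prod_congr rfl fun y _ => ?_
  simp only [rk_coe, dx_coe, Equiv.trans_apply, Equiv.symm_apply_apply, Fin.lt_def]

section
variable {k : Type} [Field k] {ι : Type} [Fintype ι] [DecidableEq ι]

lemma iPre_single (S : Finset ℕ) (ψ : ↥S ≃ Fin S.card) (I : Fin S.card → ι) :
    iPre k ι S ψ (Finsupp.single I 1) = Finsupp.single (ψ, I) 1 := by
  simp [iPre]

lemma permAct_single (deg : ι → ℤ) {n : ℕ} (τ : Equiv.Perm (Fin n)) (I : Fin n → ι) :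
    permAct k ι deg τ (Finsupp.single I 1) =
      koszulSign k (fun p => deg (I p)) τ • Finsupp.single (I ∘ τ.symm) (1 : k) := by
  rw [permAct, Finsupp.lift_apply, Finsupp.sum_single_index (by rw [zero_smul]), one_smul]

lemma iota_rel (deg : ι → ℤ) {S : Finset ℕ} (ψ ψ' : ↥S ≃ Fin S.card) (J : ↥S → ι) :
    iota k ι deg S ψ (Finsupp.single (fun r => J (ψ.symm r)) 1) =
      Kp k S (rk ψ) (rk ψ') (dx deg J) •
        iota k ι deg S ψ' (Finsupp.single (fun r => J (ψ'.symm r)) 1) := by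
  rw [← koszul_eq k deg ψ ψ' J, ← map_smul]
  have key : iPre k ι S ψ (Finsupp.single (fun r => J (ψ.symm r)) 1) -
      iPre k ι S ψ' (koszulSign k (fun p => deg (J (ψ.symm p))) (ψ.symm.trans ψ') •
        Finsupp.single (fun r => J (ψ'.symm r)) 1) ∈ tensRel k ι deg S := by
    apply Submodule.subset_span
    refine ⟨ψ, ψ.symm.trans ψ', Finsupp.single (fun r => J (ψ.symm r)) 1, ?_⟩
    rw [permAct_single]
    have e1 : ψ.trans (ψ.symm.trans ψ') = ψ' := by ext x; simp
    have e2 : (fun r => J (ψ.symm r)) ∘ (ψ.symm.trans ψ').symm = fun r => J (ψ'.symm r) := by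
      funext r; simp
    rw [e1, e2]
  exact (Submodule.Quotient.eq _).2 key

lemma end_rel (A : SympData k ι) {S : Finset ℕ} (f : EndS A S) (ψ ψ' : ↥S ≃ Fin S.card)
    (J : ↥S → ι) :
    f (iota k ι A.deg S ψ (Finsupp.single (fun r => J (ψ.symm r)) 1)) =
      Kp k S (rk ψ) (rk ψ') (dx A.deg J) *
        f (iota k ι A.deg S ψ' (Finsupp.single (fun r => J (ψ'.symm r)) 1)) := by
  rw [iota_rel A.deg ψ ψ' J, map_smul, smul_eq_mul]

lemma end_ext (A : SympData k ι) {S : Finset ℕ} (f g : EndS A S) (ψ' : ↥S ≃ Fin S.card)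
    (h : ∀ I, f (iota k ι A.deg S ψ' (Finsupp.single I 1)) =
      g (iota k ι A.deg S ψ' (Finsupp.single I 1))) : f = g := by
  apply Submodule.linearMap_qext
  apply Finsupp.lhom_ext'
  rintro ⟨ψ, I⟩
  apply LinearMap.ext_ring
  have e : ∀ f : EndS A S, f ((tensRel k ι A.deg S).mkQ (Finsupp.single (ψ, I) 1)) =
      f (iota k ι A.deg S ψ (Finsupp.single (fun r => (fun x => I (ψ x)) (ψ.symm r)) 1)) := by
    intro f
    simp only [Equiv.apply_symm_apply]
    rw [iota, LinearMap.comp_apply, iPre_single]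
  change f ((tensRel k ι A.deg S).mkQ (Finsupp.single (ψ, I) 1)) =
    g ((tensRel k ι A.deg S).mkQ (Finsupp.single (ψ, I) 1))
  rw [e, e, end_rel A f ψ ψ' (fun x => I (ψ x)), end_rel A g ψ ψ' (fun x => I (ψ x)), h]

lemma end_exists (A : SympData k ι) {S : Finset ℕ} (ψ₀ : ↥S ≃ Fin S.card) (F : (↥S → ι) → k) :
    ∃ f : EndS A S, ∀ (ψ : ↥S ≃ Fin S.card) (I : Fin S.card → ι),
      f (iota k ι A.deg S ψ (Finsupp.single I 1)) =
        Kp k S (rk ψ) (rk ψ₀) (dx A.deg (fun x => I (ψ x))) * F (fun x => I (ψ x)) := by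
  let f₀ : PreT k ι S →ₗ[k] k := Finsupp.lift k k _ (fun z : (↥S ≃ Fin S.card) × (Fin S.card → ι) =>
    Kp k S (rk z.1) (rk ψ₀) (dx A.deg (fun x => z.2 (z.1 x))) * F (fun x => z.2 (z.1 x)))
  have hf₀ : ∀ ψ I, f₀ (Finsupp.single (ψ, I) 1) =
      Kp k S (rk ψ) (rk ψ₀) (dx A.deg (fun x => I (ψ x))) * F (fun x => I (ψ x)) := by
    intro ψ I; simp [f₀]
  have hle : tensRel k ι A.deg S ≤ LinearMap.ker f₀ := by
    rw [tensRel, Submodule.span_le]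
    rintro _ ⟨ψ, τ, v, rfl⟩
    have : f₀ ∘ₗ iPre k ι S ψ = f₀ ∘ₗ iPre k ι S (ψ.trans τ) ∘ₗ permAct k ι A.deg τ := by
      apply Finsupp.lhom_ext'
      intro I
      apply LinearMap.ext_ring
      change f₀ (iPre k ι S ψ (Finsupp.single I 1)) =
        f₀ (iPre k ι S (ψ.trans τ) (permAct k ι A.deg τ (Finsupp.single I 1)))
      rw [permAct_single, map_smul, map_smul, iPre_single, iPre_single, hf₀, hf₀]
      have hk := koszul_eq k A.deg ψ (ψ.trans τ) (fun x => I (ψ x))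
      have e1 : ψ.symm.trans (ψ.trans τ) = τ := by ext x; simp
      simp only [Equiv.apply_symm_apply, e1] at hk
      rw [hk]
      simp only [Function.comp_apply, Equiv.trans_apply, Equiv.symm_apply_apply, smul_eq_mul]
      rw [Kp_eq _ _ _ _ _ (rk_inj _) (rk_inj _), Kp_eq _ _ _ _ _ (rk_inj _) (rk_inj _),
        Kp_eq _ _ _ _ _ (rk_inj _) (rk_inj _)]
      have := Ep_sq k S (rk (ψ.trans τ)) (dx A.deg (fun x => I (ψ x)))
      linear_combination (-Ep k S (rk ψ) (dx A.deg (fun x => I (ψ x))) *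
        Ep k S (rk ψ₀) (dx A.deg (fun x => I (ψ x))) * F (fun x => I (ψ x))) * this
    have h2 := LinearMap.congr_fun this v
    simp only [LinearMap.comp_apply] at h2
    simp [h2]
  refine ⟨(tensRel k ι A.deg S).liftQ f₀ hle, fun ψ I => ?_⟩
  rw [iota, LinearMap.comp_apply, iPre_single, ← hf₀]
  simp

lemma mk_equiv (S : Finset ℕ) (r : ℕ → ℕ) (hr : Set.InjOn r S) (hlt : ∀ x ∈ S, r x < S.card) :
    ∃ ψ : ↥S ≃ Fin S.card, ∀ x, (ψ x : ℕ) = r x := by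
  refine ⟨Equiv.ofBijective (fun x : ↥S => (⟨r x, hlt x x.2⟩ : Fin S.card)) ?_, fun x => rfl⟩
  rw [Fintype.bijective_iff_injective_and_card]
  refine ⟨fun x y h => ?_, by simp⟩
  simp only [Fin.mk.injEq] at h
  exact Subtype.ext (hr x.2 y.2 h)

/-- Extension of a labelling of `D` to `S`, with value `p` outside `C`. -/
def extJ {D : Finset ℕ} (S C : Finset ℕ) (J : ↥D → ι) (p : ι) : ↥S → ι :=
  fun x => if hx : (x : ℕ) ∈ D ∧ (x : ℕ) ∈ C then J ⟨x, hx.1⟩ else p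

/-- Normal form of the right-hand side. -/
def NF (A : SympData k ι) (C₁ C₂ : Finset ℕ) {S₁ S₂ D : Finset ℕ} (df dg : ℤ)
    (f : EndS A S₁) (g : EndS A S₂) (ψ₁ : ↥S₁ ≃ Fin S₁.card) (ψ₂ : ↥S₂ ≃ Fin S₂.card)
    (J : ↥D → ι) : k :=
  ∑ p : ι, ∑ q : ι,
    msign k (df + dg * (1 - A.deg p) +
      (dg + 1 - A.deg p) * (∑ x : ↥D, if (x : ℕ) ∈ C₁ then A.deg (J x) else 0)) *
    (msign k (A.deg q) * A.ω⁻¹ p q) *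
    f (iota k ι A.deg S₁ ψ₁ (Finsupp.single (fun r => extJ S₁ C₁ J p (ψ₁.symm r)) 1)) *
    g (iota k ι A.deg S₂ ψ₂ (Finsupp.single (fun r => extJ S₂ C₂ J q (ψ₂.symm r)) 1))

lemma sum_change (A : SympData k ι) (P : Matrix ι ι k) (deg' : ι → ℤ) (hP : IsUnit P)
    (hd : ∀ p i, P p i ≠ 0 → A.deg p = deg' i) (s : ℤ → k) (u v : ι → k) :
    (∑ i, ∑ j, s (deg' i) * binvOf deg' (P.transpose * A.ω * P) i j *
      (∑ p, P p i * u p) * (∑ q, P q j * v q)) =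
    ∑ p, ∑ q, s (A.deg p) * (msign k (A.deg q) * A.ω⁻¹ p q) * u p * v q := by
  set M := (P.transpose * A.ω * P)⁻¹ with hM
  have hPd : IsUnit P.det := (Matrix.isUnit_iff_isUnit_det _).1 hP
  have hPt : IsUnit P.transpose.det := by rwa [Matrix.det_transpose]
  have hinv : P * M * P.transpose = A.ω⁻¹ := by
    rw [hM, Matrix.mul_inv_rev, Matrix.mul_inv_rev, ← Matrix.mul_assoc,
      Matrix.mul_nonsing_inv _ hPd, Matrix.one_mul, Matrix.mul_assoc,
      Matrix.nonsing_inv_mul _ hPt, Matrix.mul_one]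
  have e1 : ∀ i j, s (deg' i) * binvOf deg' (P.transpose * A.ω * P) i j *
      (∑ p, P p i * u p) * (∑ q, P q j * v q) =
      ∑ p, ∑ q, s (A.deg p) * msign k (A.deg q) * u p * v q * (P p i * M i j * P q j) := by
    intro i j
    rw [mul_assoc, Finset.sum_mul_sum, Finset.mul_sum]
    refine Finset.sum_congr rfl fun p _ => ?_
    rw [Finset.mul_sum]
    refine Finset.sum_congr rfl fun q _ => ?_
    by_cases h1 : P p i = 0
    · simp [h1]
    by_cases h2 : P q j = 0
    · simp [h2]
    rw [hd p i h1, hd q j h2]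
    simp only [binvOf, ← hM]
    ring
  simp only [e1]
  have e2 : ∀ p q, A.ω⁻¹ p q = ∑ i, ∑ j, P p i * M i j * P q j := by
    intro p q
    rw [← hinv, Matrix.mul_apply, Finset.sum_comm]
    refine Finset.sum_congr rfl fun j _ => ?_
    rw [Matrix.mul_apply, Finset.sum_mul]
    rfl
  calc _ = ∑ i, ∑ p, ∑ j, ∑ q, s (A.deg p) * msign k (A.deg q) * u p * v q *
          (P p i * M i j * P q j) :=
        Finset.sum_congr rfl fun i _ => Finset.sum_comm
    _ = ∑ p, ∑ i, ∑ j, ∑ q, s (A.deg p) * msign k (A.deg q) * u p * v q *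
          (P p i * M i j * P q j) := Finset.sum_comm
    _ = ∑ p, ∑ i, ∑ q, ∑ j, s (A.deg p) * msign k (A.deg q) * u p * v q *
          (P p i * M i j * P q j) :=
        Finset.sum_congr rfl fun p _ => Finset.sum_congr rfl fun i _ => Finset.sum_comm
    _ = ∑ p, ∑ q, ∑ i, ∑ j, s (A.deg p) * msign k (A.deg q) * u p * v q *
          (P p i * M i j * P q j) :=
        Finset.sum_congr rfl fun p _ => Finset.sum_comm
    _ = _ := by
        refine Finset.sum_congr rfl fun p _ => Finset.sum_congr rfl fun q _ => ?_
        rw [e2 p q]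
        simp only [← Finset.mul_sum]
        ring

/-- The three orderings are compatible. -/
def Good (a b : ℕ) (C₁ C₂ : Finset ℕ) {S₁ S₂ D : Finset ℕ} (ψ : ↥D ≃ Fin D.card)
    (ψ₁ : ↥S₁ ≃ Fin S₁.card) (ψ₂ : ↥S₂ ≃ Fin S₂.card) : Prop :=
    (∀ x : ↥D, (x : ℕ) ∈ C₁ → (ψ x : ℕ) < C₁.card) ∧
    (∀ x : ↥S₁, ((x : ℕ) = a ↔ (ψ₁ x : ℕ) = 0)) ∧
    (∀ (x : ↥S₁) (hx : (x : ℕ) ∈ D), (x : ℕ) ∈ C₁ → (ψ₁ x : ℕ) = (ψ ⟨x, hx⟩ : ℕ) + 1) ∧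
    (∀ x : ↥S₂, ((x : ℕ) = b ↔ (ψ₂ x : ℕ) = 0)) ∧
    (∀ (x : ↥S₂) (hx : (x : ℕ) ∈ D), (x : ℕ) ∈ C₂ → (ψ₂ x : ℕ) + C₁.card = (ψ ⟨x, hx⟩ : ℕ) + 1)

lemma compProp_iff (A : SympData k ι) (P : Matrix ι ι k) (deg' : ι → ℤ) (hP : IsUnit P)
    (hd : ∀ p i, P p i ≠ 0 → A.deg p = deg' i)
    (a b : ℕ) (C₁ C₂ S₁ S₂ D : Finset ℕ) (df dg : ℤ)
    (f : EndS A S₁) (g : EndS A S₂) (h : EndS A D) :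
    CompPropWith A P deg' a b C₁ C₂ S₁ S₂ D df dg f g h ↔
      ∀ (ψ : ↥D ≃ Fin D.card) (ψ₁ : ↥S₁ ≃ Fin S₁.card) (ψ₂ : ↥S₂ ≃ Fin S₂.card),
        Good a b C₁ C₂ ψ ψ₁ ψ₂ → ∀ I : Fin D.card → ι,
        h (iota k ι A.deg D ψ (Finsupp.single I 1)) =
          NF A C₁ C₂ df dg f g ψ₁ ψ₂ (fun x => I (ψ x)) := by
  unfold CompPropWith
  refine forall_congr' fun ψ => forall_congr' fun ψ₁ => forall_congr' fun ψ₂ => ?_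
  have key : ∀ I : Fin D.card → ι, _ := fun I => sum_change A P deg' hP hd
    (fun e => msign k (df + dg * (1 - e) +
      (dg + 1 - e) * (∑ x : ↥D, if (x : ℕ) ∈ C₁ then A.deg (I (ψ x)) else 0)))
    (fun p => f (iota k ι A.deg S₁ ψ₁ (Finsupp.single
      (fun r => extJ S₁ C₁ (fun x => I (ψ x)) p (ψ₁.symm r)) 1)))
    (fun q => g (iota k ι A.deg S₂ ψ₂ (Finsupp.single
      (fun r => extJ S₂ C₂ (fun x => I (ψ x)) q (ψ₂.symm r)) 1)))
  constructor
  · rintro H ⟨h1, h2, h3, h4, h5⟩ I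
    exact (H h1 h2 h3 h4 h5 I).trans (key I)
  · intro H h1 h2 h3 h4 h5 I
    exact (H ⟨h1, h2, h3, h4, h5⟩ I).trans (key I).symm

lemma Kp_congr {S : Finset ℕ} {r r' s s' : ℕ → ℕ} {d d' : ℕ → ℤ}
    (h1 : ∀ x ∈ S, ∀ y ∈ S, (r x < r y ↔ s x < s y))
    (h2 : ∀ x ∈ S, ∀ y ∈ S, (r' x < r' y ↔ s' x < s' y))
    (h3 : ∀ x ∈ S, d x = d' x) : Kp k S r r' d = Kp k S s s' d' := by
  unfold Kp
  refine Finset.prod_congr rfl fun x hx => Finset.prod_congr rfl fun y hy => ?_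
  simp only [h1 x hx y hy, h2 y hy x hx, h3 x hx, h3 y hy]

lemma Kp_insert {C : Finset ℕ} {a : ℕ} (ha : a ∉ C) {r r' : ℕ → ℕ} {d : ℕ → ℤ}
    (hr : r a = 0) (hr' : r' a = 0) : Kp k (insert a C) r r' d = Kp k C r r' d := by
  unfold Kp
  rw [Finset.prod_insert ha]
  simp only [Finset.prod_insert ha, hr, hr']
  simp

lemma Kp_union {C₁ C₂ : Finset ℕ} (hC : Disjoint C₁ C₂) {r r' : ℕ → ℕ} {d : ℕ → ℤ}
    (hr : ∀ x ∈ C₁, ∀ y ∈ C₂, r x < r y) (hr' : ∀ x ∈ C₁, ∀ y ∈ C₂, r' x < r' y) :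
    Kp k (C₁ ∪ C₂) r r' d = Kp k C₁ r r' d * Kp k C₂ r r' d := by
  unfold Kp
  rw [Finset.prod_union hC]
  congr 1
  · refine Finset.prod_congr rfl fun x hx => ?_
    rw [Finset.prod_union hC]
    rw [Finset.prod_eq_one (s := C₂), mul_one]
    intro y hy
    simp [(hr' x hx y hy).not_gt]
  · refine Finset.prod_congr rfl fun x hx => ?_
    rw [Finset.prod_union hC]
    rw [Finset.prod_eq_one (s := C₁), one_mul]
    intro y hy
    simp [(hr y hy x hx).not_gt]

lemma good_rk {a b : ℕ} {C₁ C₂ : Finset ℕ} (hb₂ : b ∉ C₂)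
    {ψ : ↥(C₁ ∪ C₂) ≃ Fin (C₁ ∪ C₂).card}
    {ψ₁ : ↥(insert a C₁) ≃ Fin (insert a C₁).card}
    {ψ₂ : ↥(insert b C₂) ≃ Fin (insert b C₂).card} (h : Good a b C₁ C₂ ψ ψ₁ ψ₂) :
    rk ψ₁ a = 0 ∧ rk ψ₂ b = 0 ∧ (∀ x ∈ C₁, rk ψ x < C₁.card) ∧ (∀ x ∈ C₂, C₁.card ≤ rk ψ x) ∧
    (∀ x ∈ C₁, rk ψ₁ x = rk ψ x + 1) ∧ (∀ x ∈ C₂, rk ψ₂ x + C₁.card = rk ψ x + 1) := by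
  obtain ⟨h1, h2, h3, h4, h5⟩ := h
  have m1 : ∀ x ∈ C₁, x ∈ C₁ ∪ C₂ := fun x hx => Finset.mem_union_left _ hx
  have m2 : ∀ x ∈ C₂, x ∈ C₁ ∪ C₂ := fun x hx => Finset.mem_union_right _ hx
  have n1 : ∀ x ∈ C₁, x ∈ insert a C₁ := fun x hx => Finset.mem_insert_of_mem hx
  have n2 : ∀ x ∈ C₂, x ∈ insert b C₂ := fun x hx => Finset.mem_insert_of_mem hx
  have k5 : ∀ x ∈ C₂, rk ψ₂ x + C₁.card = rk ψ x + 1 := fun x hx => by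
    have := h5 ⟨x, n2 x hx⟩ (m2 x hx) hx
    rwa [← rk_coe, ← rk_coe] at this
  refine ⟨?_, ?_, ?_, ?_, ?_, k5⟩
  · have := (h2 ⟨a, Finset.mem_insert_self _ _⟩).1 rfl
    rwa [← rk_coe] at this
  · have := (h4 ⟨b, Finset.mem_insert_self _ _⟩).1 rfl
    rwa [← rk_coe] at this
  · intro x hx
    have := h1 ⟨x, m1 x hx⟩ hx
    rwa [← rk_coe] at this
  · intro x hx
    have e := k5 x hx
    have : ¬ rk ψ₂ x = 0 := by
      intro h0
      have := (h4 ⟨x, n2 x hx⟩).2 (by rw [← rk_coe]; exact h0)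
      simp only at this
      exact hb₂ (this ▸ hx)
    omega
  · intro x hx
    have := h3 ⟨x, n1 x hx⟩ (m1 x hx) hx
    rwa [← rk_coe, ← rk_coe] at this

lemma dx_extJ (deg : ι → ℤ) {D S C : Finset ℕ} (hS : C ⊆ S) (hD : C ⊆ D) (J : ↥D → ι) (p : ι)
    (x : ℕ) (hx : x ∈ C) : dx deg (extJ S C J p) x = dx deg J x := by
  simp [dx, extJ, hS hx, hD hx, hx]

lemma NF_rel (A : SympData k ι) {a b : ℕ} {C₁ C₂ : Finset ℕ}
    (ha₁ : a ∉ C₁) (hb₂ : b ∉ C₂) (hC : Disjoint C₁ C₂) (df dg : ℤ)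
    (f : EndS A (insert a C₁)) (g : EndS A (insert b C₂))
    {ψ ψ' : ↥(C₁ ∪ C₂) ≃ Fin (C₁ ∪ C₂).card}
    {ψ₁ ψ₁' : ↥(insert a C₁) ≃ Fin (insert a C₁).card}
    {ψ₂ ψ₂' : ↥(insert b C₂) ≃ Fin (insert b C₂).card} (h : Good a b C₁ C₂ ψ ψ₁ ψ₂)
    (h' : Good a b C₁ C₂ ψ' ψ₁' ψ₂') (J : ↥(C₁ ∪ C₂) → ι) :
    NF A C₁ C₂ df dg f g ψ₁ ψ₂ J =
      Kp k (C₁ ∪ C₂) (rk ψ) (rk ψ') (dx A.deg J) * NF A C₁ C₂ df dg f g ψ₁' ψ₂' J := by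
  obtain ⟨a1, a2, a3, a4, a5, a6⟩ := good_rk hb₂ h
  obtain ⟨b1, b2, b3, b4, b5, b6⟩ := good_rk hb₂ h'
  rw [Kp_union hC (fun x hx y hy => (a3 x hx).trans_le (a4 y hy))
    (fun x hx y hy => (b3 x hx).trans_le (b4 y hy))]
  unfold NF
  simp only [Finset.mul_sum (s := (Finset.univ : Finset ι))]
  refine Finset.sum_congr rfl fun p _ => Finset.sum_congr rfl fun q _ => ?_
  rw [end_rel A f ψ₁ ψ₁', end_rel A g ψ₂ ψ₂', Kp_insert ha₁ a1 b1, Kp_insert hb₂ a2 b2]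
  have e1 : Kp k C₁ (rk ψ₁) (rk ψ₁') (dx A.deg (extJ (insert a C₁) C₁ J p)) =
      Kp k C₁ (rk ψ) (rk ψ') (dx A.deg J) := by
    apply Kp_congr
    · intro x hx y hy; rw [a5 x hx, a5 y hy]; omega
    · intro x hx y hy; rw [b5 x hx, b5 y hy]; omega
    · exact dx_extJ A.deg (Finset.subset_insert _ _) Finset.subset_union_left J p
  have e2 : Kp k C₂ (rk ψ₂) (rk ψ₂') (dx A.deg (extJ (insert b C₂) C₂ J q)) =
      Kp k C₂ (rk ψ) (rk ψ') (dx A.deg J) := by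
    apply Kp_congr
    · intro x hx y hy; have := a6 x hx; have := a6 y hy; omega
    · intro x hx y hy; have := b6 x hx; have := b6 y hy; omega
    · exact dx_extJ A.deg (Finset.subset_insert _ _) Finset.subset_union_right J q
  rw [e1, e2]
  ring

lemma rk_lt {S : Finset ℕ} (ψ : ↥S ≃ Fin S.card) (x : ℕ) (hx : x ∈ S) : rk ψ x < S.card := by
  have := rk_coe ψ ⟨x, hx⟩
  simp only at this
  rw [this]; exact (ψ _).2

lemma good_exists {a b : ℕ} {C₁ C₂ : Finset ℕ} (ha₁ : a ∉ C₁) (hb₂ : b ∉ C₂)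
    (hC : Disjoint C₁ C₂) :
    ∃ (ψ : ↥(C₁ ∪ C₂) ≃ Fin (C₁ ∪ C₂).card)
      (ψ₁ : ↥(insert a C₁) ≃ Fin (insert a C₁).card)
      (ψ₂ : ↥(insert b C₂) ≃ Fin (insert b C₂).card), Good a b C₁ C₂ ψ ψ₁ ψ₂ := by
  have hd : ∀ x ∈ C₂, x ∉ C₁ := fun x hx hx' => Finset.disjoint_left.1 hC hx' hx
  have i1 := rk_inj C₁.equivFin
  have i2 := rk_inj C₂.equivFin
  have l1 := rk_lt C₁.equivFin
  have l2 := rk_lt C₂.equivFin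
  generalize rk C₁.equivFin = r₁ at *
  generalize rk C₂.equivFin = r₂ at *
  have aux : ∀ (c : ℕ) (C : Finset ℕ) (r : ℕ → ℕ), c ∉ C → Set.InjOn r C →
      (∀ x ∈ C, r x < C.card) → ∃ φ : ↥(insert c C) ≃ Fin (insert c C).card,
        ∀ x, (φ x : ℕ) = if (x : ℕ) = c then 0 else r x + 1 := by
    intro c C r hc hi hl
    apply mk_equiv _ (fun x => if x = c then 0 else r x + 1)
    · intro x hx y hy h
      simp only [Finset.coe_insert, Set.mem_insert_iff, Finset.mem_coe] at hx hy
      simp only at h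
      split_ifs at h with g1 g2 g2
      · rw [g1, g2]
      · exact hi (by simpa [g1] using hx) (by simpa [g2] using hy) (by omega)
    · intro x hx
      rw [Finset.card_insert_of_notMem hc]
      split_ifs with g
      · omega
      · have := hl x (by simpa [g] using hx)
        omega
  obtain ⟨ψ₁, h₁⟩ := aux a C₁ r₁ ha₁ i1 l1
  obtain ⟨ψ₂, h₂⟩ := aux b C₂ r₂ hb₂ i2 l2
  obtain ⟨ψ, h⟩ := mk_equiv (C₁ ∪ C₂) (fun x => if x ∈ C₁ then r₁ x else C₁.card + r₂ x)
    (by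
      intro x hx y hy h
      simp only [Finset.coe_union, Set.mem_union, Finset.mem_coe] at hx hy
      simp only at h
      split_ifs at h with g1 g2 g2
      · exact i1 g1 g2 h
      · have := l1 x g1; omega
      · have := l1 y g2; omega
      · exact i2 (by simpa [g1] using hx) (by simpa [g2] using hy) (by omega))
    (by
      intro x hx
      rw [Finset.card_union_of_disjoint hC]
      split_ifs with g
      · have := l1 x g; omega
      · have := l2 x (by simpa [g] using hx); omega)
  refine ⟨ψ, ψ₁, ψ₂, ?_, ?_, ?_, ?_, ?_⟩
  · intro x hx
    rw [h, if_pos hx]; exact l1 _ hx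
  · intro x
    rw [h₁]; split_ifs with g <;> simp [g]
  · intro x hx hx1
    have : (x : ℕ) ≠ a := fun e => ha₁ (e ▸ hx1)
    rw [h₁, h, if_neg this, if_pos hx1]
  · intro x
    rw [h₂]; split_ifs with g <;> simp [g]
  · intro x hx hx1
    have : (x : ℕ) ≠ b := fun e => hb₂ (e ▸ hx1)
    rw [h₂, h, if_neg this, if_neg (hd _ hx1)]
    simp only
    omega

end

/-- for a dg symplectic space `A`, disjoint finite label sets
`C₁ ∌ a`, `C₂ ∌ b` and homogeneous `f ∈ End_A(C₁⊔{a},G₁)`, `g ∈ End_A(C₂⊔{b},G₂)`,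
there is a unique `∘_{a,b}(f⊗g) ∈ End_A(C₁⊔C₂,G₁+G₂)` satisfying the defining
formula for every bijection `ψ : C₁⊔C₂ ≅ [|C₁|+|C₂|]` with `ψ(C₁) = [|C₁|]`;
moreover the defining formula is independent of the choice of homogeneous
basis of `A`. -/
theorem statement2 {k : Type} [Field k] {ι : Type} [Fintype ι] [DecidableEq ι]
    (A : SympData k ι) (a b : ℕ) (C₁ C₂ : Finset ℕ) (G₁ G₂ : ℕ)
    (hab : a ≠ b) (ha₁ : a ∉ C₁) (hb₂ : b ∉ C₂)
    (hdisj : Disjoint (insert a C₁) (insert b C₂))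
    (hst₁ : StableCorolla (insert a C₁) G₁) (hst₂ : StableCorolla (insert b C₂) G₂)
    (df dg : ℤ) (f : EndS A (insert a C₁)) (g : EndS A (insert b C₂))
    (hf : IsHomogEnd A f df) (hg : IsHomogEnd A g dg) :
    -- existence and uniqueness
    (∃! h : EndS A (C₁ ∪ C₂),
      CompProp A a b C₁ C₂ (insert a C₁) (insert b C₂) (C₁ ∪ C₂) df dg f g h) ∧
    -- independence of the choice of homogeneous basis
    (∀ (P : Matrix ι ι k) (deg' : ι → ℤ), IsUnit P →
      (∀ p i, P p i ≠ 0 → A.deg p = deg' i) →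
      ∀ h : EndS A (C₁ ∪ C₂),
        (CompPropWith A P deg' a b C₁ C₂ (insert a C₁) (insert b C₂) (C₁ ∪ C₂)
            df dg f g h ↔
          CompProp A a b C₁ C₂ (insert a C₁) (insert b C₂) (C₁ ∪ C₂) df dg f g h)) := by
  have hC : Disjoint C₁ C₂ := hdisj.mono (Finset.subset_insert _ _) (Finset.subset_insert _ _)
  have h1 := compProp_iff A 1 A.deg isUnit_one
    (fun p i hpi => by
      by_contra hne
      exact hpi (Matrix.one_apply_ne (fun e => hne (by rw [e]))))
    a b C₁ C₂ (insert a C₁) (insert b C₂) (C₁ ∪ C₂) df dg f g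
  refine ⟨?_, ?_⟩
  · obtain ⟨ψ₀, φ₁, φ₂, h₀⟩ := good_exists ha₁ hb₂ hC
    obtain ⟨h, hh⟩ := end_exists A ψ₀ (NF A C₁ C₂ df dg f g φ₁ φ₂)
    refine ⟨h, (h1 h).2 ?_, ?_⟩
    · intro ψ ψ₁ ψ₂ hG I
      rw [hh, NF_rel A ha₁ hb₂ hC df dg f g hG h₀]
    · intro h' hh'
      apply end_ext A _ _ ψ₀
      intro I
      rw [(h1 h').1 hh' ψ₀ φ₁ φ₂ h₀ I, hh, ← NF_rel A ha₁ hb₂ hC df dg f g h₀ h₀]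
  · intro P deg' hP hd h
    exact (compProp_iff A P deg' hP hd a b C₁ C₂ (insert a C₁) (insert b C₂) (C₁ ∪ C₂)
      df dg f g h).trans (h1 h).symm

end Paper
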